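/- arXiv:1202.3320 — 2 statements merged into one kernel-verified Lean document; each statement's English description precedes it below -/
import Mathlib

section
/- Let λ, μ² be nonzero rational numbers (viewed inside ℂ) and let J ∈ ℂ be transcendental over ℚ. Then every complex stationary point of the φ⁴ potential V is nonsingular (det H_V(q) ≠ 0), and the set of complex stationary points of V has exactly 3^N distinct elements, where N = L². -/
open scoped BigOperators

/-- The four unit shifts (±1,0), (0,±1) on the periodic lattice `ZMod L × ZMod L`,
listed with multiplicity. -/
def shifts (L : ℕ) : List (ZMod L × ZMod L) := [(1, 0), (-1, 0), (0, 1), (0, -1)]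

/-- The φ⁴ potential on the periodic `L × L` square lattice (real configurations). -/
noncomputable def phi4V (L : ℕ) [NeZero L] (lam mu2 J : ℝ) (q : ZMod L × ZMod L → ℝ) : ℝ :=
  ∑ i : ZMod L × ZMod L,
    (lam / 24 * q i ^ 4 - mu2 / 2 * q i ^ 2
      + J / 4 * ((shifts L).map (fun d => (q i - q (i + d)) ^ 2)).sum)

/-- The partial derivative ∂V/∂q_k of the φ⁴ potential (real configurations). -/
noncomputable def phi4Grad (L : ℕ) (lam mu2 J : ℝ) (q : ZMod L × ZMod L → ℝ)
    (k : ZMod L × ZMod L) : ℝ :=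
  lam / 6 * q k ^ 3 - mu2 * q k + J * ((shifts L).map (fun d => q k - q (k + d))).sum

/-- The Hessian of the φ⁴ potential: the matrix of second partial derivatives,
`H k l = ∂/∂q_l (∂V/∂q_k)` (real configurations). -/
noncomputable def phi4Hess (L : ℕ) [NeZero L] (lam mu2 J : ℝ)
    (q : ZMod L × ZMod L → ℝ) : Matrix (ZMod L × ZMod L) (ZMod L × ZMod L) ℝ :=
  Matrix.of fun k l =>
    fderiv ℝ (fun p : ZMod L × ZMod L → ℝ => phi4Grad L lam mu2 J p k) q (Pi.single l 1)

/-- The φ⁴ potential on the periodic `L × L` square lattice (complex configurations). -/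
noncomputable def phi4VC (L : ℕ) [NeZero L] (lam mu2 J : ℂ) (q : ZMod L × ZMod L → ℂ) : ℂ :=
  ∑ i : ZMod L × ZMod L,
    (lam / 24 * q i ^ 4 - mu2 / 2 * q i ^ 2
      + J / 4 * ((shifts L).map (fun d => (q i - q (i + d)) ^ 2)).sum)

/-- The partial derivative ∂V/∂q_k of the φ⁴ potential (complex configurations). -/
noncomputable def phi4GradC (L : ℕ) (lam mu2 J : ℂ) (q : ZMod L × ZMod L → ℂ)
    (k : ZMod L × ZMod L) : ℂ :=
  lam / 6 * q k ^ 3 - mu2 * q k + J * ((shifts L).map (fun d => q k - q (k + d))).sum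

/-- The Hessian of the φ⁴ potential (complex configurations). -/
noncomputable def phi4HessC (L : ℕ) [NeZero L] (lam mu2 J : ℂ)
    (q : ZMod L × ZMod L → ℂ) : Matrix (ZMod L × ZMod L) (ZMod L × ZMod L) ℂ :=
  Matrix.of fun k l =>
    fderiv ℂ (fun p : ZMod L × ZMod L → ℂ => phi4GradC L lam mu2 J p k) q (Pi.single l 1)

section Generic
open MvPolynomial TensorProduct

variable {ι : Type} [Fintype ι] [DecidableEq ι] {S : Type} [CommRing S]

noncomputable def cubPoly (B : ι → ι → S) (k : ι) : MvPolynomial ι S :=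
  X k ^ 3 - ∑ i, C (B k i) * X i

abbrev CubAlg (B : ι → ι → S) : Type :=
  MvPolynomial ι S ⧸ (Ideal.span (Set.range (cubPoly B)))

noncomputable def cubX (B : ι → ι → S) (k : ι) : CubAlg B := Ideal.Quotient.mk _ (X k)

lemma cubX_cube (B : ι → ι → S) (k : ι) :
    cubX B k ^ 3 = ∑ i, algebraMap S (CubAlg B) (B k i) * cubX B i := by
  have h : (Ideal.Quotient.mk (Ideal.span (Set.range (cubPoly B)))) (cubPoly B k) = 0 :=
    Ideal.Quotient.eq_zero_iff_mem.2 (Ideal.subset_span ⟨k, rfl⟩)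
  rw [cubPoly, map_sub, sub_eq_zero, map_pow, map_sum] at h
  rw [cubX, h]
  refine Finset.sum_congr rfl fun i _ => ?_
  rw [map_mul]
  rfl

noncomputable def cubHomEquiv (B : ι → ι → S) (K : Type) [CommRing K] [Algebra S K] :
    (CubAlg B →ₐ[S] K) ≃ {q : ι → K // ∀ k, q k ^ 3 = ∑ i, algebraMap S K (B k i) * q i} where
  toFun φ := ⟨fun k => φ (cubX B k), fun k => by
    rw [← map_pow, cubX_cube, map_sum]
    simp⟩
  invFun q := Ideal.Quotient.liftₐ _ (aeval q.1) (by
    intro a ha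
    have : Ideal.span (Set.range (cubPoly B)) ≤ RingHom.ker (aeval q.1 : MvPolynomial ι S →ₐ[S] K) := by
      rw [Ideal.span_le]
      rintro _ ⟨k, rfl⟩
      simp [RingHom.mem_ker, cubPoly, q.2 k]
    exact this ha)
  left_inv φ := by
    apply Ideal.Quotient.algHom_ext
    apply MvPolynomial.algHom_ext
    intro i
    exact aeval_X (fun k => φ (cubX B k)) i
  right_inv q := by
    ext k
    exact (Ideal.Quotient.lift_mk _ _ _).trans (aeval_X _ k)

lemma cub_finite (B : ι → ι → S) : Module.Finite S (CubAlg B) := by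
  classical
  let mon : (ι →₀ ℕ) → CubAlg B := fun e => ∏ i, cubX B i ^ e i
  let T : Set (CubAlg B) := Set.range fun e : ι → Fin 3 => ∏ i, cubX B i ^ (e i : ℕ)
  have hT : T.Finite := Set.finite_range _
  have hmul : ∀ (e : ι →₀ ℕ) i, mon (e + Finsupp.single i 1) = mon e * cubX B i := by
    intro e i
    simp only [mon, Finsupp.add_apply, pow_add, Finset.prod_mul_distrib]
    congr 1
    rw [Finset.prod_eq_single i] <;> simp +contextual [Finsupp.single_apply, eq_comm]
  have key : ∀ n : ℕ, ∀ e : ι →₀ ℕ, e.degree = n → mon e ∈ Submodule.span S T := by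
    intro n
    induction n using Nat.strong_induction_on with
    | _ n ih =>
      intro e he
      by_cases h : ∀ i, e i < 3
      · exact Submodule.subset_span ⟨fun i => ⟨e i, h i⟩, rfl⟩
      · push Not at h
        obtain ⟨k, hk⟩ := h
        obtain ⟨e', rfl⟩ : ∃ e', e = e' + Finsupp.single k 1 + Finsupp.single k 1 + Finsupp.single k 1 := by
          refine ⟨e - Finsupp.single k 3, ?_⟩
          ext j
          simp only [Finsupp.add_apply, Finsupp.tsub_apply, Finsupp.single_apply]
          split_ifs with hj
          · subst hj; omega
          · simp
        have : mon (e' + Finsupp.single k 1 + Finsupp.single k 1 + Finsupp.single k 1)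
            = ∑ i, algebraMap S (CubAlg B) (B k i) * mon (e' + Finsupp.single i 1) := by
          simp only [hmul]
          rw [show mon e' * cubX B k * cubX B k * cubX B k = mon e' * cubX B k ^ 3 by ring,
            cubX_cube, Finset.mul_sum]
          exact Finset.sum_congr rfl fun i _ => by ring
        rw [this]
        refine Submodule.sum_mem _ fun i _ => ?_
        rw [← Algebra.smul_def]
        refine Submodule.smul_mem _ _ (ih _ ?_ _ rfl)
        simp only [map_add, Finsupp.degree_single] at he ⊢
        omega
  refine ⟨⟨hT.toFinset, ?_⟩⟩
  rw [Set.Finite.coe_toFinset, eq_top_iff]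
  rintro x -
  obtain ⟨p, rfl⟩ := Ideal.Quotient.mk_surjective x
  induction p using MvPolynomial.induction_on' with
  | monomial e a =>
    have : (Ideal.Quotient.mk (Ideal.span (Set.range (cubPoly B)))) (monomial e a) = algebraMap S (CubAlg B) a * mon e := by
      rw [monomial_eq, map_mul, Finsupp.prod_fintype _ _ (by simp), map_prod]
      simp only [map_pow]
      rfl
    rw [this, ← Algebra.smul_def]
    exact Submodule.smul_mem _ _ (key _ e rfl)
  | add p q hp hq => rw [map_add]; exact Submodule.add_mem _ hp hq

noncomputable def cubJac (B : ι → ι → S) : Matrix ι ι (CubAlg B) :=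
  Matrix.of fun k l => (if k = l then 3 * cubX B k ^ 2 else 0) - algebraMap S _ (B k l)

lemma cub_etale (B : ι → ι → S) (h : IsUnit (cubJac B).det) :
    Algebra.Etale S (CubAlg B) := by
  let P := Algebra.PreSubmersivePresentation.naive (v := cubPoly B) (id : ι → ι) Function.injective_id
  have hP : P.jacobian = (cubJac B).det := by
    rw [Algebra.PreSubmersivePresentation.jacobian_eq_jacobiMatrix_det, RingHom.map_det,
      ← Matrix.det_transpose]
    congr 1
    ext k l
    simp only [Matrix.transpose_apply, RingHom.mapMatrix_apply, Matrix.map_apply, P]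
    rw [Algebra.PreSubmersivePresentation.jacobiMatrix_naive]
    have : (pderiv (id l)) (cubPoly B k) = (if k = l then 3 * X k ^ 2 else 0) - C (B k l) := by
      simp only [cubPoly, map_sub, map_sum, id, pderiv_pow, pderiv_C_mul, pderiv_X, Pi.single_apply]
      congr 1
      · rcases eq_or_ne k l with rfl | h
        · simp
        · simp [h, Ne.symm h]
      · simp [Finset.sum_ite_eq, Finset.smul_sum, smul_eq_C_mul]
    rw [this, cubJac, Matrix.of_apply, map_sub]
    congr 1
    · rcases eq_or_ne k l with rfl | h
      · simp [cubX, Algebra.Generators.algebraMap_apply]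
      · simp [h]
  let Q : Algebra.SubmersivePresentation S (CubAlg B) ι ι := { P with jacobian_isUnit := hP ▸ h }
  have : Algebra.IsStandardSmoothOfRelativeDimension 0 S (CubAlg B) :=
    Q.isStandardSmoothOfRelativeDimension (by simp [Algebra.Presentation.dimension])
  infer_instance

lemma etale_card (K A : Type) [Field K] [IsAlgClosed K] [CommRing A] [Algebra K A]
    [Algebra.Etale K A] : Nat.card (A →ₐ[K] K) = Module.finrank K A := by
  have := Algebra.FormallyUnramified.finite_of_free K A
  have : IsArtinianRing A := isArtinian_of_tower K inferInstance
  apply le_antisymm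
  · exact card_algHom_le_finrank K A K
  · let e := Algebra.FormallyEtale.equivPiOfIsSepClosed K A
    have := Fintype.ofFinite (PrimeSpectrum A)
    rw [e.toLinearEquiv.finrank_eq, Module.finrank_fintype_fun_eq_card, ← Nat.card_eq_fintype_card]
    refine Nat.card_le_card_of_injective
      (fun p => (Pi.evalAlgHom K (fun _ : PrimeSpectrum A => K) p).comp e.toAlgHom) ?_
    intro p q hpq
    classical
    by_contra hne
    have := DFunLike.congr_fun hpq (e.symm (Pi.single p 1))
    simp [Ne.symm hne] at this

lemma cub_card [IsLocalRing S] (B : ι → ι → S) (h : IsUnit (cubJac B).det)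
    (K : Type) [Field K] [IsAlgClosed K] [Algebra S K] :
    Nat.card {q : ι → K // ∀ k, q k ^ 3 = ∑ i, algebraMap S K (B k i) * q i}
      = Module.finrank S (CubAlg B) := by
  have := cub_etale B h
  have := cub_finite B
  have : Module.Free S (CubAlg B) := Module.free_of_flat_of_isLocalRing
  rw [← Nat.card_congr (cubHomEquiv B K), ← Module.finrank_baseChange (R := K),
    ← etale_card K (K ⊗[S] CubAlg B)]
  refine Nat.card_congr ?_
  exact Algebra.TensorProduct.liftEquivRight S K _ K

lemma cub_unit [IsLocalRing S] [Algebra ℚ S] (B : ι → ι → S) (m : ℚ) (hm : m ≠ 0)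
    (hB : ∀ k l, B k l - (if k = l then algebraMap ℚ S m else 0) ∈ IsLocalRing.maximalIdeal S) :
    IsUnit (cubJac B).det := by
  by_contra hu
  obtain ⟨M, hM, hmem⟩ := exists_max_ideal_of_mem_nonunits hu
  have := cub_finite B
  have : (M.comap (algebraMap S (CubAlg B))).IsMaximal :=
    Ideal.isMaximal_comap_of_isIntegral_of_isMaximal M
  have hcm := IsLocalRing.eq_maximalIdeal this
  let _ := Ideal.Quotient.field M
  let π := Ideal.Quotient.mk M
  have hπB : ∀ k l, π (algebraMap S _ (B k l)) = if k = l then algebraMap ℚ _ m else 0 := by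
    intro k l
    have h1 := hB k l
    rw [← hcm, Ideal.mem_comap, ← Ideal.Quotient.eq_zero_iff_mem, map_sub, map_sub, sub_eq_zero] at h1
    rw [h1]
    split_ifs
    · exact DFunLike.congr_fun (RingHom.ext_rat ((π.comp (algebraMap S _)).comp (algebraMap ℚ S)) (algebraMap ℚ _)) m
    · simp
  have hx : ∀ k, π (cubX B k) ^ 3 = algebraMap ℚ _ m * π (cubX B k) := by
    intro k
    rw [← map_pow, cubX_cube, map_sum]
    simp only [map_mul, hπB]
    simp
  have hd : π (cubJac B).det = ∏ k, (3 * π (cubX B k) ^ 2 - algebraMap ℚ _ m) := by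
    rw [RingHom.map_det, ← Matrix.det_diagonal]
    congr 1
    ext k l
    rcases eq_or_ne k l with rfl | h
    · simp [cubJac, hπB, show π 3 = 3 from map_ofNat π 3]
    · simp [cubJac, hπB, h]
  have h0 : π (cubJac B).det = 0 := Ideal.Quotient.eq_zero_iff_mem.2 hmem
  rw [hd, Finset.prod_eq_zero_iff] at h0
  obtain ⟨k, -, hk⟩ := h0
  have hmm : algebraMap ℚ (CubAlg B ⧸ M) m ≠ 0 := by
    rw [Ne, map_eq_zero]; exact hm
  have h2 : (2 : CubAlg B ⧸ M) ≠ 0 := by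
    have : algebraMap ℚ (CubAlg B ⧸ M) 2 ≠ 0 := by
      rw [Ne, map_eq_zero]; norm_num
    simpa using this
  have h3 : π (cubX B k) * (2 * algebraMap ℚ (CubAlg B ⧸ M) m) = 0 := by
    linear_combination (π (cubX B k)) * hk - 3 * hx k
  rcases mul_eq_zero.1 h3 with h | h
  · rw [h] at hk
    apply hmm
    linear_combination - hk
  · exact mul_ne_zero h2 hmm h

lemma card_zero (K : Type) [Field K] [CharZero K] [IsAlgClosed K] (m : K) (hm : m ≠ 0) :
    Nat.card {q : ι → K // ∀ k, q k ^ 3 = m * q k} = 3 ^ Fintype.card ι := by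
  classical
  have e : {q : ι → K // ∀ k, q k ^ 3 = m * q k} ≃ (ι → {x : K // x ^ 3 = m * x}) :=
    Equiv.subtypePiEquivPi (p := fun (_ : ι) (x : K) => x ^ 3 = m * x)
  rw [Nat.card_congr e, Nat.card_fun]
  congr 1
  · obtain ⟨s, hs⟩ := IsAlgClosed.exists_pow_nat_eq m (n := 2) (by norm_num)
    have hs0 : s ≠ 0 := by rintro rfl; apply hm; rw [← hs]; ring
    have hss : -s ≠ s := by
      intro h; apply hs0; linear_combination (-1/2) * h
    have : {x : K | x ^ 3 = m * x} = (({0, s, -s} : Finset K) : Set K) := by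
      ext x
      simp only [Set.mem_ofPred_eq, Finset.coe_insert, Finset.coe_singleton, Set.mem_insert_iff,
        Set.mem_singleton_iff]
      constructor
      · intro h
        have : x * ((x - s) * (x + s)) = 0 := by linear_combination h - x * hs
        rcases mul_eq_zero.1 this with h | h
        · exact .inl h
        rcases mul_eq_zero.1 h with h | h
        · exact .inr (.inl (sub_eq_zero.1 h))
        · exact .inr (.inr (eq_neg_of_add_eq_zero_left h))
      · rintro (rfl | rfl | rfl)
        · simp
        · rw [← hs]; ring
        · rw [← hs]; ring
    change Nat.card ({x : K | x ^ 3 = m * x} : Set K) = 3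
    rw [this, Nat.card_coe_set_eq, Set.ncard_coe_finset]
    rw [Finset.card_insert_of_notMem, Finset.card_insert_of_notMem] <;> simp [hs0, Ne.symm hs0, hss, Ne.symm hss]
  · exact Nat.card_eq_fintype_card

end Generic

section Lattice

def latB {R : Type} [CommRing R] (L : ℕ) (a m j : R) (k i : ZMod L × ZMod L) : R :=
  a * (m * (if k = i then 1 else 0) -
    j * ((shifts L).map (fun d => (if k = i then 1 else 0) - (if k + d = i then 1 else 0))).sum)

lemma latB_map {R T : Type} [CommRing R] [CommRing T] (f : R →+* T) (L : ℕ) (a m j : R)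
    (k i : ZMod L × ZMod L) : f (latB L a m j k i) = latB L (f a) (f m) (f j) k i := by
  simp [latB, shifts, apply_ite f]

lemma latB_sum {R : Type} [CommRing R] (L : ℕ) [NeZero L] (a m j : R)
    (q : ZMod L × ZMod L → R) (k : ZMod L × ZMod L) :
    ∑ i, latB L a m j k i * q i =
      a * (m * q k - j * ((shifts L).map (fun d => q k - q (k + d))).sum) := by
  simp [latB, shifts, mul_assoc, ← Finset.mul_sum, sub_mul, add_mul, Finset.sum_add_distrib,
    Finset.sum_sub_distrib]

lemma grad_iff (L : ℕ) [NeZero L] (lam mu2 J : ℂ) (hlam : lam ≠ 0) (q : ZMod L × ZMod L → ℂ)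
    (k : ZMod L × ZMod L) :
    phi4GradC L lam mu2 J q k = 0 ↔ q k ^ 3 = ∑ i, latB L (6 / lam) mu2 J k i * q i := by
  rw [latB_sum, phi4GradC]
  set s := ((shifts L).map (fun d => q k - q (k + d))).sum
  constructor
  · intro h
    field_simp
    linear_combination 6 * h
  · intro h
    rw [h]
    field_simp
    ring

lemma hess_eq (L : ℕ) [NeZero L] (lam mu2 J : ℂ) (hlam : lam ≠ 0) (q : ZMod L × ZMod L → ℂ) :
    phi4HessC L lam mu2 J q = (lam / 6) • Matrix.of fun k l =>
      (if k = l then 3 * q k ^ 2 else 0) - latB L (6 / lam) mu2 J k l := by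
  ext k l
  have hp : ∀ i, HasFDerivAt (𝕜 := ℂ) (fun p : ZMod L × ZMod L → ℂ => p i)
      (ContinuousLinearMap.proj i) q := fun i => hasFDerivAt_apply i q
  have h := ((((hp k).pow 3).const_mul (lam / 6)).sub ((hp k).const_mul mu2)).add
      ((((hp k).sub (hp (k + (1, 0)))).add (((hp k).sub (hp (k + (-1, 0)))).add
        (((hp k).sub (hp (k + (0, 1)))).add
        (((hp k).sub (hp (k + (0, -1)))).add (hasFDerivAt_const (0 : ℂ) q))))).const_mul J)
  have h' : fderiv ℂ (fun p : ZMod L × ZMod L → ℂ => phi4GradC L lam mu2 J p k) q = _ := h.fderiv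
  rw [phi4HessC, Matrix.of_apply, h']
  simp only [Matrix.smul_apply, Matrix.of_apply, latB, shifts]
  simp [Pi.single_apply]
  field_simp
  split_ifs <;> ring

end Lattice

open Polynomial in
theorem phi4_transcendental_coupling (L : ℕ) [NeZero L] (hL : 2 ≤ L)
    (lam mu2 : ℚ) (hlam : lam ≠ 0) (hmu : mu2 ≠ 0) (J : ℂ) (hJ : Transcendental ℚ J) :
    (∀ q : ZMod L × ZMod L → ℂ, (∀ k, phi4GradC L (lam : ℂ) (mu2 : ℂ) J q k = 0) →
      (phi4HessC L (lam : ℂ) (mu2 : ℂ) J q).det ≠ 0) ∧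
    {q : ZMod L × ZMod L → ℂ |
      ∀ k, phi4GradC L (lam : ℂ) (mu2 : ℂ) J q k = 0}.ncard = 3 ^ (L ^ 2) := by
  have hlamC : (lam : ℂ) ≠ 0 := by exact_mod_cast hlam
  have hmuC : (mu2 : ℂ) ≠ 0 := by exact_mod_cast hmu
  let P : Ideal ℚ[X] := RingHom.ker (evalRingHom (0 : ℚ))
  have : P.IsPrime := RingHom.ker_isPrime _
  let S := Localization.AtPrime P
  let B : (ZMod L × ZMod L) → (ZMod L × ZMod L) → S :=
    latB L (algebraMap ℚ[X] S (C (6 / lam))) (algebraMap ℚ[X] S (C mu2)) (algebraMap ℚ[X] S X)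
  have hm : 6 / lam * mu2 ≠ 0 := mul_ne_zero (div_ne_zero (by norm_num) hlam) hmu
  have hU : IsUnit (cubJac B).det := by
    refine cub_unit B (6 / lam * mu2) hm ?_
    intro k l
    have : B k l - (if k = l then algebraMap ℚ S (6 / lam * mu2) else 0) =
        algebraMap ℚ[X] S (- latB L (C (6 / lam)) 0 (-X) k l) := by
      rw [map_neg, latB_map]
      have h1 : algebraMap ℚ S (6 / lam * mu2) =
          algebraMap ℚ[X] S (C (6 / lam)) * algebraMap ℚ[X] S (C mu2) := by
        rw [← map_mul, ← C_mul]
        exact IsScalarTower.algebraMap_apply ℚ ℚ[X] S _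
      rw [h1]
      simp only [B, latB, map_neg, map_zero]
      split_ifs <;> ring
    rw [this, IsLocalization.AtPrime.to_map_mem_maximal_iff S P, RingHom.mem_ker, map_neg, latB_map]
    simp [latB]
  -- specializations
  have hsol : ∀ φ : S →+* ℂ, ∀ q : ZMod L × ZMod L → ℂ, 
      (∀ k, q k ^ 3 = ∑ i, φ (B k i) * q i) ↔ 
      ∀ k, phi4GradC L (lam : ℂ) (mu2 : ℂ) (φ (algebraMap ℚ[X] S X)) q k = 0 := by
    intro φ q
    refine forall_congr' fun k => ?_
    have hC : ∀ r : ℚ, φ (algebraMap ℚ[X] S (C r)) = r := fun r =>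
      DFunLike.congr_fun (RingHom.ext_rat ((φ.comp (algebraMap ℚ[X] S)).comp C) (algebraMap ℚ ℂ)) r
    simp only [B, latB_map, hC]
    rw [grad_iff L _ _ _ hlamC]
    push_cast
    rfl
  have hB : ∀ φ : S →+* ℂ, ∀ k l, 
      φ (B k l) = latB L (6 / (lam : ℂ)) (mu2 : ℂ) (φ (algebraMap ℚ[X] S X)) k l := by
    intro φ k l
    have hC : ∀ r : ℚ, φ (algebraMap ℚ[X] S (C r)) = r := fun r =>
      DFunLike.congr_fun (RingHom.ext_rat ((φ.comp (algebraMap ℚ[X] S)).comp C) (algebraMap ℚ ℂ)) r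
    simp only [B, latB_map, hC]
    push_cast
    rfl
  obtain ⟨φ, hφ⟩ : ∃ φ : S →+* ℂ, φ (algebraMap ℚ[X] S X) = J := by
    refine ⟨IsLocalization.lift (M := P.primeCompl) (g := (aeval J : ℚ[X] →ₐ[ℚ] ℂ).toRingHom) ?_, ?_⟩
    · intro y
      rw [isUnit_iff_ne_zero]
      intro h
      have h0 : (y : ℚ[X]) = 0 := by
        by_contra hy
        exact hJ ⟨y, hy, h⟩
      exact y.2 (by rw [h0]; exact P.zero_mem)
    · rw [IsLocalization.lift_eq]
      simp
  obtain ⟨ψ, hψ⟩ : ∃ ψ : S →+* ℂ, ψ (algebraMap ℚ[X] S X) = 0 := by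
    refine ⟨IsLocalization.lift (M := P.primeCompl) (g := (aeval (0 : ℂ) : ℚ[X] →ₐ[ℚ] ℂ).toRingHom) ?_, ?_⟩
    · intro y
      rw [isUnit_iff_ne_zero]
      intro h
      apply y.2
      change eval 0 (y : ℚ[X]) = 0
      have h' : aeval (0 : ℂ) (y : ℚ[X]) = 0 := h
      rw [← coeff_zero_eq_aeval_zero'] at h'
      rw [← coeff_zero_eq_eval_zero]
      simpa using h'
    · rw [IsLocalization.lift_eq]
      simp
  have hcount : Nat.card {q : ZMod L × ZMod L → ℂ // ∀ k, q k ^ 3 = ∑ i, φ (B k i) * q i} =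
      Nat.card {q : ZMod L × ZMod L → ℂ // ∀ k, q k ^ 3 = ∑ i, ψ (B k i) * q i} := by
    trans Module.finrank S (CubAlg B)
    · let _ : Algebra S ℂ := φ.toAlgebra
      exact cub_card B hU ℂ
    · let _ : Algebra S ℂ := ψ.toAlgebra
      exact (cub_card B hU ℂ).symm
  constructor
  · intro q hq
    rw [hess_eq L _ _ _ hlamC, Matrix.det_smul]
    refine mul_ne_zero (pow_ne_zero _ (div_ne_zero hlamC (by norm_num))) ?_
    let _ : Algebra S ℂ := φ.toAlgebra
    rw [← hφ] at hq
    let e := (cubHomEquiv B ℂ).symm ⟨q, (hsol φ q).2 hq⟩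
    have he : ∀ k, e (cubX B k) = q k := fun k => 
      congrFun (congrArg Subtype.val ((cubHomEquiv B ℂ).apply_symm_apply ⟨q, (hsol φ q).2 hq⟩)) k
    have h1 := (hU.map e).ne_zero
    rw [AlgHom.map_det] at h1
    convert h1 using 2
    ext k l
    have h2 : e (algebraMap S (CubAlg B) (B k l)) = φ (B k l) := e.commutes _
    have h3 := hB φ k l
    rw [hφ] at h3
    simp only [Matrix.of_apply, AlgHom.mapMatrix_apply, Matrix.map_apply, cubJac, map_sub, h2, h3]
    split_ifs
    · simp [he, show e 3 = 3 from map_ofNat e 3]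
    · simp
  · have h1 : {q : ZMod L × ZMod L → ℂ | ∀ k, phi4GradC L (lam : ℂ) (mu2 : ℂ) J q k = 0} =
        {q | ∀ k, q k ^ 3 = ∑ i, φ (B k i) * q i} := by
      ext q
      have := hsol φ q
      rw [hφ] at this
      exact this.symm
    rw [h1, ← Nat.card_coe_set_eq]
    refine hcount.trans ?_
    have h2 : ∀ q : ZMod L × ZMod L → ℂ, (∀ k, q k ^ 3 = ∑ i, ψ (B k i) * q i) ↔
        ∀ k, q k ^ 3 = (6 / (lam : ℂ) * mu2) * q k := by
      intro q
      refine forall_congr' fun k => ?_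
      simp only [hB, hψ, latB_sum]
      ring_nf
    rw [Nat.card_congr (Equiv.subtypeEquivRight h2), card_zero]
    · congr 1
      simp [ZMod.card, sq]
    · exact mul_ne_zero (div_ne_zero (by norm_num) hlamC) hmuC
end

section
/- For nonzero λ, μ² ∈ ℂ, the set of real couplings J ∈ ℝ for which, for every lattice size L ≥ 2, all complex stationary points of the L×L φ⁴ potential are nonsingular (i.e. V is a Morse function for every L) is the complement in ℝ of a countable set; in particular it is uncountable and dense in ℝ. -/
open scoped BigOperators

/-- The set of real couplings J for which, for every lattice size L ≥ 2, all complex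
stationary points of the L × L φ⁴ potential are nonsingular (V is a Morse function). -/
def morseCouplings (lam mu2 : ℂ) : Set ℝ :=
  {J : ℝ | ∀ L : ℕ, ∀ _hL : 2 ≤ L,
    haveI : NeZero L := ⟨by omega⟩
    ∀ q : ZMod L × ZMod L → ℂ,
      (∀ k, phi4GradC L lam mu2 (J : ℂ) q k = 0) →
        (phi4HessC L lam mu2 (J : ℂ) q).det ≠ 0}

open MvPolynomial in
lemma aux_finite {σ R A : Type*} [Fintype σ] [DecidableEq σ] [CommRing R] [CommRing A] [Algebra R A]
    (f : MvPolynomial σ R →ₐ[R] A) (hf : Function.Surjective f) (c : σ → σ → R)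
    (h : ∀ k, f (X k) ^ 3 = ∑ l, c k l • f (X l)) : Module.Finite R A := by
  set T : Set (σ →₀ ℕ) := {m | ∀ i, m i ≤ 2} with hT
  have hTf : T.Finite := by
    refine (Set.finite_Icc (0 : σ →₀ ℕ) (Finsupp.equivFunOnFinite.symm fun _ => 2)).subset ?_
    intro m hm
    refine ⟨zero_le, fun i => ?_⟩
    simpa using hm i
  set S : Submodule R A := Submodule.span R ((fun m => f (monomial m 1)) '' T) with hS
  have key : ∀ d : ℕ, ∀ m : σ →₀ ℕ, m.degree = d → f (monomial m 1) ∈ S := by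
    intro d
    induction d using Nat.strong_induction_on with
    | _ d ih =>
      intro m hm
      by_cases hmT : m ∈ T
      · exact Submodule.subset_span ⟨m, hmT, rfl⟩
      · simp only [hT, Set.mem_ofPred_eq, not_forall, not_le] at hmT
        obtain ⟨k, hk⟩ := hmT
        obtain ⟨n, rfl⟩ : ∃ n, m = n + Finsupp.single k 3 := by
          refine ⟨m - Finsupp.single k 3, (tsub_add_cancel_of_le ?_).symm⟩
          rw [Finsupp.single_le_iff]
          omega
        have e : f (monomial (n + Finsupp.single k 3) 1)
            = ∑ l, c k l • f (monomial (n + Finsupp.single l 1) 1) := by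
          have e1 : ∀ l (j : ℕ), (monomial (n + Finsupp.single l j) (1:R))
              = monomial n 1 * X l ^ j := by
            intro l j
            rw [X_pow_eq_monomial, monomial_mul, one_mul]
          simp only [e1, map_mul, map_pow, h, pow_one, Finset.mul_sum, mul_smul_comm]
        rw [e]
        refine Submodule.sum_mem _ fun l _ => Submodule.smul_mem _ _ (ih _ ?_ _ rfl)
        rw [← hm]
        simp
  refine ⟨⟨(hTf.image (fun m => f (monomial m 1))).toFinset, ?_⟩⟩
  rw [Set.Finite.coe_toFinset, eq_top_iff]
  rintro a -
  obtain ⟨p, rfl⟩ := hf a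
  rw [p.as_sum, map_sum]
  refine Submodule.sum_mem _ fun m _ => ?_
  have : (monomial m (coeff m p)) = (coeff m p) • monomial m (1 : R) := by
    rw [smul_monomial, smul_eq_mul, mul_one]
  rw [this, map_smul]
  exact Submodule.smul_mem _ _ (key _ m rfl)

lemma aux_rel {σ R A : Type*} [Fintype σ] [DecidableEq σ] [CommRing R] [CommRing A] [Algebra R A]
    (y : σ → A) (a a' m j : R) (K : σ → σ → R) (ha : a' * a = 1) (k : σ)
    (h : a • y k ^ 3 - m • y k + j • ∑ l, K k l • y l = 0) :
    y k ^ 3 = ∑ l, (a' * ((if l = k then m else 0) - j * K k l)) • y l := by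
  have h2 : ∀ l, (a' * ((if l = k then m else 0) - j * K k l)) • y l
      = (if l = k then a' • m • y k else 0) - a' • j • K k l • y l := by
    intro l
    split_ifs with hl
    · subst hl; rw [mul_sub, sub_smul]; simp only [mul_smul]
    · rw [zero_sub, mul_neg, neg_smul, zero_sub]; simp only [mul_smul]
  simp only [h2, Finset.sum_sub_distrib, Finset.sum_ite_eq', Finset.mem_univ, if_true]
  rw [← Finset.smul_sum, ← Finset.smul_sum]
  have h3 : a' • (a • y k ^ 3 - m • y k + j • ∑ l, K k l • y l) = 0 := by rw [h, smul_zero]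
  rw [smul_add, smul_sub, smul_smul, ha, one_smul] at h3
  linear_combination h3

open Polynomial in
lemma aux_nak {σ Q : Type*} [Fintype σ] [DecidableEq σ] [CommRing Q] [Algebra ℂ[X] Q]
    (lam mu2 : ℂ) (hlam : lam ≠ 0) (hmu : mu2 ≠ 0) (K : Matrix σ σ ℂ)
    (f : MvPolynomial σ ℂ[X] →ₐ[ℂ[X]] Q) (hf : Function.Surjective f)
    (cc : ℂ →+* Q) (hcc : ∀ z, cc z = algebraMap ℂ[X] Q (C z))
    (jj : Q) (hjj : jj = algebraMap ℂ[X] Q X)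
    (y : σ → Q) (hy : ∀ k, y k = f (MvPolynomial.X k))
    (hg : ∀ k, cc (lam / 6) * y k ^ 3 - cc mu2 * y k + jj * ∑ l, cc (K k l) * y l = 0)
    (hH : (Matrix.diagonal (fun k => cc (lam / 2) * y k ^ 2 - cc mu2) + jj • K.map cc).det = 0) :
    ∃ r : ℂ[X], r ≠ 0 ∧ algebraMap ℂ[X] Q r = 0 := by
  have hfin : Module.Finite ℂ[X] Q := by
    refine aux_finite f hf
      (fun k l => Polynomial.C (6 / lam) *
        ((if l = k then Polynomial.C mu2 else 0) - Polynomial.X * Polynomial.C (K k l))) ?_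
    simp only [← hy]
    refine fun k => aux_rel y (Polynomial.C (lam / 6)) (Polynomial.C (6 / lam))
      (Polynomial.C mu2) Polynomial.X (fun k l => Polynomial.C (K k l)) ?_ k ?_
    · rw [← Polynomial.C_mul, ← Polynomial.C_1]
      congr 1
      field_simp
    · simp only [Algebra.smul_def, ← hcc, ← hjj]
      exact hg k
  have hJ : (1 : Q) ∈ Ideal.span {jj} := by
    rw [← Ideal.Quotient.eq_zero_iff_mem, map_one]
    set F : Q →+* (Q ⧸ Ideal.span {jj}) := Ideal.Quotient.mk _ with hF
    have hFj : F jj = 0 := by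
      rw [hF, Ideal.Quotient.eq_zero_iff_mem]
      exact Ideal.subset_span rfl
    clear_value F
    have hdet : (0 : Q ⧸ Ideal.span {jj}) = ∏ k, F (cc (lam / 2) * y k ^ 2 - cc mu2) := by
      rw [← map_zero F, ← hH, RingHom.map_det, ← Matrix.det_diagonal]
      congr 1
      ext a b
      by_cases hab : a = b
      · subst hab; simp [hFj]
      · simp [hFj, hab]
    have hu : IsUnit (0 : Q ⧸ Ideal.span {jj}) := by
      rw [hdet, IsUnit.prod_univ_iff]
      intro k
      have hg1 : F (cc (lam / 6) * y k ^ 3 - cc mu2 * y k) = 0 := by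
        have := congrArg F (hg k)
        rw [map_add, map_mul F jj, hFj, zero_mul, add_zero, map_zero] at this
        exact this
      have h3 : F ((cc (lam / 2) * y k ^ 2 - cc mu2) * (cc (lam / 2) * y k ^ 2 - cc (2 * mu2)))
          = F (cc (2 * mu2 ^ 2)) := by
        have : ((cc (lam / 2) * y k ^ 2 - cc mu2) * (cc (lam / 2) * y k ^ 2 - cc (2 * mu2)))
          = cc (2 * mu2 ^ 2) + cc (3 * lam / 2) * y k * (cc (lam / 6) * y k ^ 3 - cc mu2 * y k) := by
          have e1 : cc (lam / 2) = 3 * cc (lam / 6) := by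
            rw [← map_ofNat cc, ← map_mul]; congr 1; ring
          have e2 : cc (3 * lam / 2) = 9 * cc (lam / 6) := by
            rw [← map_ofNat cc, ← map_mul]; congr 1; ring
          rw [e1, e2]
          simp only [map_mul, map_pow, map_ofNat]
          ring
        rw [this, map_add, map_mul F _ (_ - _), hg1, mul_zero, add_zero]
      have h4 : IsUnit (F (cc (2 * mu2 ^ 2))) := by
        have : IsUnit (2 * mu2 ^ 2) := by
          rw [isUnit_iff_ne_zero]
          exact mul_ne_zero two_ne_zero (pow_ne_zero 2 hmu)
        exact (this.map cc).map F
      rw [← h3, map_mul] at h4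
      exact isUnit_of_mul_isUnit_left h4
    exact (isUnit_zero_iff.mp hu).symm
  obtain ⟨b, hb⟩ := Ideal.mem_span_singleton'.mp hJ
  obtain ⟨r, hr1, hr⟩ := Submodule.exists_sub_one_mem_and_smul_eq_zero_of_fg_of_le_smul
    (Ideal.span {(Polynomial.X : ℂ[X])}) (⊤ : Submodule ℂ[X] Q) hfin.1 (by
      intro m _
      have : m = (Polynomial.X : ℂ[X]) • (b * m) := by
        rw [Algebra.smul_def, ← hjj, ← mul_assoc, mul_comm _ b, hb, one_mul]
      rw [this]
      exact Submodule.smul_mem_smul (Ideal.subset_span rfl) trivial)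
  refine ⟨r, ?_, ?_⟩
  · rintro rfl
    rw [Ideal.mem_span_singleton, Polynomial.X_dvd_iff] at hr1
    simp at hr1
  · have := hr 1 trivial
    rwa [Algebra.smul_def, mul_one] at this

lemma aux_map {σ P B : Type*} [Fintype σ] [DecidableEq σ] [CommRing P] [CommRing B]
    (lam mu2 : ℂ) (K : Matrix σ σ ℂ) (cc : ℂ →+* P) (jj : P) (x : σ → P) (φ : P →+* B) :
    φ (Matrix.diagonal (fun k => cc (lam / 2) * x k ^ 2 - cc mu2) + jj • K.map cc).det
      = (Matrix.diagonal (fun k => φ.comp cc (lam / 2) * φ (x k) ^ 2 - φ.comp cc mu2)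
        + φ jj • K.map (φ.comp cc)).det := by
  rw [RingHom.map_det]
  congr 1
  ext a b
  by_cases hab : a = b
  · subst hab
    simp only [RingHom.mapMatrix_apply, Matrix.map_apply, Matrix.add_apply,
      Matrix.diagonal_apply_eq, Matrix.smul_apply, smul_eq_mul, map_add, map_sub, map_mul,
      map_pow, RingHom.comp_apply]
  · simp only [RingHom.mapMatrix_apply, Matrix.map_apply, Matrix.add_apply,
      Matrix.diagonal_apply_ne _ hab, Matrix.smul_apply, smul_eq_mul, map_add, map_mul,
      map_zero, RingHom.comp_apply]

lemma aux_map' {σ P B : Type*} [Fintype σ] [CommRing P] [CommRing B]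
    (lam mu2 : ℂ) (K : Matrix σ σ ℂ) (cc : ℂ →+* P) (jj : P) (x : σ → P) (φ : P →+* B) (k : σ) :
    φ (cc (lam / 6) * x k ^ 3 - cc mu2 * x k + jj * ∑ l, cc (K k l) * x l)
      = φ.comp cc (lam / 6) * φ (x k) ^ 3 - φ.comp cc mu2 * φ (x k)
        + φ jj * ∑ l, φ.comp cc (K k l) * φ (x l) := by
  simp only [map_add, map_sub, map_mul, map_pow, map_sum, RingHom.comp_apply]

/-- the ideal generated by the gradient and the Hessian determinant -/
def auxI {σ P : Type*} [Fintype σ] [DecidableEq σ] [CommRing P]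
    (lam mu2 : ℂ) (K : Matrix σ σ ℂ) (cc : ℂ →+* P) (jj : P) (x : σ → P) : Ideal P :=
  Ideal.span (insert
    (Matrix.diagonal (fun k => cc (lam / 2) * x k ^ 2 - cc mu2) + jj • K.map cc).det
    (Set.range fun k => cc (lam / 6) * x k ^ 3 - cc mu2 * x k + jj * ∑ l, cc (K k l) * x l))

lemma auxI_le {σ P : Type*} [Fintype σ] [DecidableEq σ] [CommRing P]
    (lam mu2 : ℂ) (K : Matrix σ σ ℂ) (cc : ℂ →+* P) (jj : P) (x : σ → P) (φ : P →+* ℂ)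
    (J : ℂ) (q : σ → ℂ) (φc : φ.comp cc = RingHom.id ℂ) (φj : φ jj = J) (φx : ∀ k, φ (x k) = q k)
    (hq : ∀ k, lam / 6 * q k ^ 3 - mu2 * q k + J * ∑ l, K k l * q l = 0)
    (hd : (Matrix.diagonal (fun k => lam / 2 * q k ^ 2 - mu2) + J • K).det = 0) :
    auxI lam mu2 K cc jj x ≤ RingHom.ker φ := by
  rw [auxI, Ideal.span_le]
  rintro p (rfl | ⟨k, rfl⟩)
  · change φ _ = 0
    rw [aux_map, ← hd]
    simp only [φc, φj, φx, RingHom.id_apply]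
    congr 1
  · change φ _ = 0
    rw [aux_map', ← hq k]
    simp only [φc, φj, φx, RingHom.id_apply]

open Polynomial in
lemma aux_quot {σ P : Type*} [Fintype σ] [DecidableEq σ] [CommRing P] [Algebra ℂ[X] P]
    (lam mu2 : ℂ) (hlam : lam ≠ 0) (hmu : mu2 ≠ 0)
    (K : Matrix σ σ ℂ) (e : MvPolynomial σ ℂ[X] →ₐ[ℂ[X]] P) (he : Function.Surjective e)
    (cc : ℂ →+* P) (hcc : ∀ z, cc z = algebraMap ℂ[X] P (C z)) (jj : P)
    (hjj : jj = algebraMap ℂ[X] P X) (x : σ → P) (hx : ∀ k, x k = e (MvPolynomial.X k)) :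
    ∃ r : ℂ[X], r ≠ 0 ∧ algebraMap ℂ[X] P r ∈ auxI lam mu2 K cc jj x := by
  obtain ⟨I, hI⟩ : ∃ I, I = auxI lam mu2 K cc jj x := ⟨_, rfl⟩
  rw [← hI]
  have hg : ∀ k, Ideal.Quotient.mk I
      (cc (lam / 6) * x k ^ 3 - cc mu2 * x k + jj * ∑ l, cc (K k l) * x l) = 0 := fun k => by
    rw [Ideal.Quotient.eq_zero_iff_mem, hI]
    exact Ideal.subset_span (Or.inr ⟨k, rfl⟩)
  have hH : Ideal.Quotient.mk I
      (Matrix.diagonal (fun k => cc (lam / 2) * x k ^ 2 - cc mu2) + jj • K.map cc).det = 0 := by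
    rw [Ideal.Quotient.eq_zero_iff_mem, hI]
    exact Ideal.subset_span (Or.inl rfl)
  have hg2 := fun k => (aux_map' lam mu2 K cc jj x (Ideal.Quotient.mk I) k).symm.trans (hg k)
  have hH2 := (aux_map lam mu2 K cc jj x (Ideal.Quotient.mk I)).symm.trans hH
  obtain ⟨r, hr0, hr⟩ := aux_nak lam mu2 hlam hmu K ((Ideal.Quotient.mkₐ ℂ[X] I).comp e)
    ((Ideal.Quotient.mkₐ_surjective ℂ[X] I).comp he) ((Ideal.Quotient.mk I).comp cc)
    (fun z => by rw [RingHom.comp_apply, hcc]; rfl)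
    (Ideal.Quotient.mk I jj) (by rw [hjj]; rfl) (fun k => Ideal.Quotient.mk I (x k))
    (fun k => by rw [hx]; rfl) hg2 hH2
  exact ⟨r, hr0, Ideal.Quotient.eq_zero_iff_mem.mp hr⟩

open Polynomial in
lemma aux_bad {σ : Type} [Fintype σ] [DecidableEq σ] (lam mu2 : ℂ) (hlam : lam ≠ 0) (hmu : mu2 ≠ 0)
    (K : Matrix σ σ ℂ) :
    ∃ r : ℂ[X], r ≠ 0 ∧ ∀ (J : ℂ) (q : σ → ℂ),
      (∀ k, lam / 6 * q k ^ 3 - mu2 * q k + J * ∑ l, K k l * q l = 0) →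
      (Matrix.diagonal (fun k => lam / 2 * q k ^ 2 - mu2) + J • K).det = 0 → r.eval J = 0 := by
  obtain ⟨r, hr0, hr⟩ := aux_quot lam mu2 hlam hmu K (AlgHom.id ℂ[X] (MvPolynomial σ ℂ[X]))
    Function.surjective_id ((MvPolynomial.C).comp (Polynomial.C)) (fun z => rfl)
    (MvPolynomial.C Polynomial.X) rfl MvPolynomial.X (fun k => rfl)
  refine ⟨r, hr0, fun J q hq hd => ?_⟩
  have := auxI_le lam mu2 K _ _ _ (MvPolynomial.eval₂Hom (Polynomial.evalRingHom J) q) J q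
    (RingHom.ext fun z => by simp) (by simp) (fun k => by simp) hq hd hr
  rw [RingHom.mem_ker, MvPolynomial.algebraMap_eq, MvPolynomial.eval₂Hom_C] at this
  exact this

lemma aux_L (lam mu2 : ℂ) (hlam : lam ≠ 0) (hmu : mu2 ≠ 0) (L : ℕ) [NeZero L] :
    {J : ℝ | ∃ q : ZMod L × ZMod L → ℂ, (∀ k, phi4GradC L lam mu2 (J : ℂ) q k = 0) ∧
        (phi4HessC L lam mu2 (J : ℂ) q).det = 0}.Finite := by
  let ι := ZMod L × ZMod L
  let s : ι → ι → ℂ := fun l k => (Pi.single l 1 : ι → ℂ) k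
  let K : Matrix ι ι ℂ := Matrix.of fun k l =>
    ((shifts L).map (fun d => s l k - s l (k + d))).sum
  have hs : ∀ (q : ι → ℂ) k, ∑ l, s l k * q l = q k := by
    intro q k
    simp [s, Pi.single_apply]
  have hK : ∀ (q : ι → ℂ) k, ∑ l, K k l * q l
      = ((shifts L).map (fun d => q k - q (k + d))).sum := by
    intro q k
    simp only [K, shifts, List.map_cons, List.map_nil, List.sum_cons, List.sum_nil,
      Matrix.of_apply, add_mul, sub_mul, Finset.sum_add_distrib, Finset.sum_sub_distrib, hs,
      zero_mul, Finset.sum_const_zero]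
  obtain ⟨r, hr0, hr⟩ := aux_bad lam mu2 hlam hmu K
  have hfin : {z : ℂ | r.eval z = 0}.Finite := by
    refine (r.roots.toFinset.finite_toSet).subset ?_
    intro z hz
    simpa [hr0] using hz
  refine (hfin.preimage (Complex.ofReal_injective.injOn)).subset ?_
  rintro J ⟨q, hq, hd⟩
  refine hr J q ?_ ?_
  · intro k
    rw [hK]
    exact hq k
  · rw [← hd]
    congr 1
    ext k l
    have hp : ∀ j : ι, HasFDerivAt (fun p : ι → ℂ => p j)
        (ContinuousLinearMap.proj (R := ℂ) (φ := fun _ : ι => ℂ) j) q :=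
      fun j => hasFDerivAt_apply j q
    have hD := ((((hp k).pow 3).const_mul (lam / 6)).sub ((hp k).const_mul mu2)).add
      (((((hp k).sub (hp (k + (1, 0)))).add (((hp k).sub (hp (k + (-1, 0)))).add
        (((hp k).sub (hp (k + (0, 1)))).add ((hp k).sub (hp (k + (0, -1)))))))).const_mul (J : ℂ))
    have hD' := hD.congr_of_eventuallyEq (f₁ := fun p : ι → ℂ => phi4GradC L lam mu2 J p k)
      (Filter.Eventually.of_forall fun p => by
        simp only [phi4GradC, shifts, List.map_cons, List.map_nil, List.sum_cons, List.sum_nil,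
          add_zero]
        rfl)
    have hE := congrArg (fun D : (ι → ℂ) →L[ℂ] ℂ => D (Pi.single l 1)) hD'.fderiv
    change phi4HessC L lam mu2 J q k l = _ at hE
    rw [hE]
    have hdiag : Matrix.diagonal (fun k => lam / 2 * q k ^ 2 - mu2) k l
        = (lam / 2 * q k ^ 2 - mu2) * s l k := by
      by_cases hkl : k = l
      · subst hkl; simp [s]
      · simp [s, hkl, Pi.single_apply]
    rw [Matrix.add_apply, hdiag]
    simp [K, shifts, s]
    ring

theorem phi4_morse_couplings_cocountable (lam mu2 : ℂ) (hlam : lam ≠ 0) (hmu : mu2 ≠ 0) :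
    (∃ C : Set ℝ, C.Countable ∧ morseCouplings lam mu2 = Cᶜ) ∧
    ¬ (morseCouplings lam mu2).Countable ∧ Dense (morseCouplings lam mu2) := by
  have hC : ((morseCouplings lam mu2)ᶜ).Countable := by
    have : (⋃ n : ℕ, {J : ℝ | ∃ q : ZMod (n+2) × ZMod (n+2) → ℂ,
        (∀ k, phi4GradC (n+2) lam mu2 (J : ℂ) q k = 0) ∧
        (phi4HessC (n+2) lam mu2 (J : ℂ) q).det = 0}).Countable :=
      Set.countable_iUnion fun n => (aux_L lam mu2 hlam hmu (n+2)).countable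
    refine this.mono ?_
    intro J hJ
    simp only [morseCouplings, Set.mem_compl_iff, Set.mem_ofPred_eq, not_forall] at hJ
    obtain ⟨L, hL, q, hq, hd⟩ := hJ
    obtain ⟨n, rfl⟩ : ∃ n, L = n + 2 := ⟨L - 2, by omega⟩
    rw [Set.mem_iUnion]
    exact ⟨n, q, hq, not_not.mp hd⟩
  refine ⟨⟨_, hC, (compl_compl _).symm⟩, ?_, ?_⟩
  · intro h
    have := h.union hC
    rw [Set.union_compl_self] at this
    exact Cardinal.not_countable_real this
  · have := hC.dense_compl ℝ
    rwa [compl_compl] at this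
end
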